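/- Suppose v ∈ F_X ∩ K for a covector X ∈ L(A,K), and let T, T' be topes of L(A,K). Then (v,T) ∼ (v,T') in K × T(A,K) if and only if K_{X,T} = K_{X,T'}. -/

import Mathlib

/-- Composition of sign vectors: `(X ∘ Y) e = X e` if `X e ≠ 0`, and `Y e` otherwise. -/
def scomp {E : Type*} (X Y : E → SignType) : E → SignType :=
  fun e => if X e = 0 then Y e else X e

/-- The partial order on sign vectors: `X ≤ Y` iff `X ∘ Y = Y`. -/
def sle {E : Type*} (X Y : E → SignType) : Prop := scomp X Y = Y

theorem sle_refl {E : Type*} (X : E → SignType) : sle X X := by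
  funext e; show (if X e = 0 then X e else X e) = X e; split <;> rfl

theorem sle_trans {E : Type*} {X Y Z : E → SignType} (h₁ : sle X Y) (h₂ : sle Y Z) :
    sle X Z := by
  funext e
  have h1 := congrFun h₁ e
  have h2 := congrFun h₂ e
  revert h1 h2
  show (if X e = 0 then Y e else X e) = Y e → (if Y e = 0 then Z e else Y e) = Z e →
    (if X e = 0 then Z e else X e) = Z e
  generalize X e = a; generalize Y e = b; generalize Z e = c
  revert a b c; decide

theorem sle_antisymm {E : Type*} {X Y : E → SignType} (h₁ : sle X Y) (h₂ : sle Y X) :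
    X = Y := by
  funext e
  have h1 := congrFun h₁ e
  have h2 := congrFun h₂ e
  revert h1 h2
  show (if X e = 0 then Y e else X e) = Y e → (if Y e = 0 then X e else Y e) = X e → X e = Y e
  generalize X e = a; generalize Y e = b
  revert a b; decide

/-- The separating set of two sign vectors: the indices where they take opposite
nonzero signs. -/
def SepSet {E : Type*} (X Y : E → SignType) : Set E :=
  {e | (X e = 1 ∧ Y e = -1) ∨ (X e = -1 ∧ Y e = 1)}

section Geometry

variable {E : Type*} {V : Type*} [NormedAddCommGroup V] [NormedSpace ℝ V]

/-- The face of a sign vector `X`, relative to the family of cooriented affine hyperplanes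
`H_e = {v | f e v = 0}`, with positive side `H_e⁺ = {v | f e v > 0}` and negative side
`H_e⁻ = {v | f e v < 0}`. -/
def face (f : E → (V →ᵃ[ℝ] ℝ)) (X : E → SignType) : Set V :=
  {v | ∀ e, SignType.sign (f e v) = X e}

/-- The conditional oriented matroid `L(A,K)`: the set of sign vectors whose face
meets `K`. -/
def covs (f : E → (V →ᵃ[ℝ] ℝ)) (K : Set V) : Set (E → SignType) :=
  {X | (face f X ∩ K).Nonempty}

/-- A tope of `L(A,K)`: a maximal covector. -/
def IsTope (f : E → (V →ᵃ[ℝ] ℝ)) (K : Set V) (T : E → SignType) : Prop :=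
  T ∈ covs f K ∧ ∀ Y ∈ covs f K, sle T Y → Y = T

/-- The set of topes of `L(A,K)`, as a type carrying the discrete topology. -/
def Topes (f : E → (V →ᵃ[ℝ] ℝ)) (K : Set V) : Type _ := {T : E → SignType // IsTope f K T}

instance (f : E → (V →ᵃ[ℝ] ℝ)) (K : Set V) : TopologicalSpace (Topes f K) := ⊥

instance (f : E → (V →ᵃ[ℝ] ℝ)) (K : Set V) : DiscreteTopology (Topes f K) := ⟨rfl⟩

/-- Points of `K × T(A,K)`. -/
abbrev ZPre (f : E → (V →ᵃ[ℝ] ℝ)) (K : Set V) : Type _ := K × Topes f K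

/-- The gluing relation defining `Z(A,K)`: `(v,T) ∼ (v',T')` iff `v = v'` and `v` lies on
no hyperplane separating `T` from `T'`. -/
def ZRel (f : E → (V →ᵃ[ℝ] ℝ)) (K : Set V) : ZPre f K → ZPre f K → Prop :=
  fun p q => (p.1 : V) = (q.1 : V) ∧ ∀ e ∈ SepSet p.2.1 q.2.1, f e (p.1 : V) ≠ 0

/-- The space `Z(A,K)`: one copy of `K` for each tope, glued along the complement of the
separating hyperplanes, with the quotient topology. -/
def ZSpace (f : E → (V →ᵃ[ℝ] ℝ)) (K : Set V) : Type _ := Quot (ZRel f K)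

instance (f : E → (V →ᵃ[ℝ] ℝ)) (K : Set V) : TopologicalSpace (ZSpace f K) :=
  inferInstanceAs (TopologicalSpace (Quot (ZRel f K)))

/-- The projection `π : Z(A,K) → V` (with image `K`), sending `[(v,T)]` to `v`. -/
def Zproj (f : E → (V →ᵃ[ℝ] ℝ)) (K : Set V) : ZSpace f K → V :=
  Quot.lift (fun p => (p.1 : V)) (fun _ _ h => h.1)

/-- The set `K_{X,T} = K ∩ ⋂_{e : X_e = 0} H_e^{T_e}`. -/
def KXT (f : E → (V →ᵃ[ℝ] ℝ)) (K : Set V) (X T : E → SignType) : Set V :=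
  K ∩ ⋂ e ∈ {e | X e = 0}, {v | SignType.sign (f e v) = T e}

/-- The subset `U_{X,T} ⊆ Z(A,K)`: the image of `K_{X,T} × {T}` under the quotient map. -/
def UXT (f : E → (V →ᵃ[ℝ] ℝ)) (K : Set V) (X : E → SignType) (T : Topes f K) :
    Set (ZSpace f K) :=
  {z | ∃ (v : V) (hv : v ∈ K), v ∈ KXT f K X T.1 ∧ z = Quot.mk (ZRel f K) (⟨v, hv⟩, T)}

/-- The complexified complement `M(A,K)`, where `V ⊗ ℂ` is modeled as `V × V` (real and
imaginary parts): `v + iw` lies on `H_e ⊗ ℂ` iff `f e v = 0` and the linear part of `f e`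
vanishes on `w`. -/
def MSpace (f : E → (V →ᵃ[ℝ] ℝ)) (K : Set V) : Type _ :=
  {p : V × V // p.1 ∈ K ∧ ∀ e, ¬(f e p.1 = 0 ∧ (f e).linear p.2 = 0)}

instance (f : E → (V →ᵃ[ℝ] ℝ)) (K : Set V) : TopologicalSpace (MSpace f K) :=
  inferInstanceAs (TopologicalSpace {p : V × V // p.1 ∈ K ∧ _})

/-- The projection `ρ : M(A,K) → V` (with image `K`), sending `v + iw` to `v`. -/
def Mproj (f : E → (V →ᵃ[ℝ] ℝ)) (K : Set V) : MSpace f K → V := fun p => p.1.1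

end Geometry

variable {V : Type*} [NormedAddCommGroup V] [NormedSpace ℝ V] [FiniteDimensional ℝ V]
variable {E : Type*} [Fintype E]

/-- A family of signs of nonzero values is unchanged by a small displacement along a line. -/
theorem eventually_sign_line_eq {V : Type*} [NormedAddCommGroup V] [NormedSpace ℝ V]
    (g : V →ᵃ[ℝ] ℝ) (w d : V) (hw : g w ≠ 0) :
    ∀ᶠ t : ℝ in nhds 0, SignType.sign (g (t • d + w)) = SignType.sign (g w) := by
  have hline (t : ℝ) : g (t • d + w) = t * g.linear d + g w := by
    simpa using g.map_vadd w (t • d)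
  simp only [hline]
  have hcont : Filter.Tendsto (fun t : ℝ => t * g.linear d + g w) (nhds 0) (nhds (g w)) := by
    have : Continuous fun t : ℝ => t * g.linear d + g w := by fun_prop
    simpa using this.tendsto 0
  rcases lt_or_gt_of_ne hw with h | h
  · filter_upwards [hcont.eventually (gt_mem_nhds h)] with t ht
    rw [sign_neg ht, sign_neg h]
  · filter_upwards [hcont.eventually (lt_mem_nhds h)] with t ht
    rw [sign_pos ht, sign_pos h]

/-- If no hyperplane is degenerate and `K` is open, topes have full support. -/
theorem IsTope.ne_zero {V : Type*} [NormedAddCommGroup V] [NormedSpace ℝ V]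
    {E : Type*} [Finite E] {f : E → (V →ᵃ[ℝ] ℝ)} (hf : ∀ e, (f e).linear ≠ 0)
    {K : Set V} (hK : IsOpen K) {T : E → SignType} (hT : IsTope f K T) (e : E) : T e ≠ 0 := by
  intro he
  obtain ⟨⟨w, hwT, hwK⟩, hmax⟩ := hT
  obtain ⟨d, hd⟩ : ∃ d, (f e).linear d ≠ 0 := by
    by_contra! h
    exact hf e (LinearMap.ext h)
  have hmem : ∀ᶠ t : ℝ in nhds 0, t • d + w ∈ K := by
    have : Continuous fun t : ℝ => t • d + w := by fun_prop
    exact this.continuousAt.eventually_mem (hK.mem_nhds (by simpa using hwK))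
  have hsign : ∀ᶠ t : ℝ in nhds 0, ∀ i, T i ≠ 0 →
      SignType.sign (f i (t • d + w)) = T i := by
    refine Filter.eventually_all.2 fun i => ?_
    by_cases hi : T i = 0
    · simp [hi]
    · have hw : f i w ≠ 0 := fun h => hi (by rw [← hwT i, h, sign_zero])
      filter_upwards [eventually_sign_line_eq (f i) w d hw] with t ht _
      rw [ht, hwT i]
  obtain ⟨t, ⟨htK, htT⟩, ht0⟩ :=
    (((hmem.and hsign).filter_mono nhdsWithin_le_nhds).and
      (self_mem_nhdsWithin : {(0 : ℝ)}ᶜ ∈ nhdsWithin 0 {(0 : ℝ)}ᶜ)).exists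
  have hYT := hmax (fun i => SignType.sign (f i (t • d + w))) ⟨_, fun _ => rfl, htK⟩ (by
    funext i
    by_cases hi : T i = 0
    · simp [scomp, hi]
    · simp [scomp, hi, htT i hi])
  have hzero : f e (t • d + w) = 0 := sign_eq_zero_iff.1 ((congrFun hYT e).trans he)
  have hwe : f e w = 0 := sign_eq_zero_iff.1 ((hwT e).trans he)
  have hline : f e (t • d + w) = t * (f e).linear d + f e w := by
    simpa using (f e).map_vadd w (t • d)
  rw [hline, hwe, add_zero] at hzero
  exact mul_ne_zero ht0 hd hzero

/-- Two full-support sign vectors agree off their separating set. -/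
theorem eq_of_notMem_SepSet {E : Type*} {X Y : E → SignType} {e : E}
    (hX : X e ≠ 0) (hY : Y e ≠ 0) (h : e ∉ SepSet X Y) : X e = Y e := by
  revert hX hY h
  change X e ≠ 0 → Y e ≠ 0 → ¬((X e = 1 ∧ Y e = -1) ∨ (X e = -1 ∧ Y e = 1)) → X e = Y e
  generalize X e = a; generalize Y e = b
  revert a b; decide

theorem ne_of_mem_SepSet {E : Type*} {X Y : E → SignType} {e : E}
    (h : e ∈ SepSet X Y) : X e ≠ Y e := by
  rcases h with ⟨h, h'⟩ | ⟨h, h'⟩ <;> rw [h, h'] <;> decide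

/-- Suppose `v ∈ F_X ∩ K` for a covector `X ∈ L(A,K)`, and let `T, T'` be topes of
`L(A,K)`.  Then `(v,T) ∼ (v,T')` in `K × T(A,K)` if and only if `K_{X,T} = K_{X,T'}`. -/
theorem zrel_iff_KXT_eq
    (f : E → (V →ᵃ[ℝ] ℝ)) (hf : ∀ e, (f e).linear ≠ 0)
    (K : Set V) (hKne : K.Nonempty) (hKconv : Convex ℝ K) (hKopen : IsOpen K)
    (X : E → SignType) (hX : X ∈ covs f K)
    (v : V) (hvX : v ∈ face f X) (hvK : v ∈ K)
    (T T' : Topes f K) :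
    ZRel f K (⟨v, hvK⟩, T) (⟨v, hvK⟩, T') ↔ KXT f K X T.1 = KXT f K X T'.1 := by
  constructor
  · rintro ⟨-, hsep⟩
    have heq : ∀ e, X e = 0 → T.1 e = T'.1 e := fun e he =>
      eq_of_notMem_SepSet (T.2.ne_zero hf hKopen e) (T'.2.ne_zero hf hKopen e) fun hmem =>
        hsep e hmem (sign_eq_zero_iff.1 ((hvX e).trans he))
    unfold KXT
    congr 1
    exact Set.iInter₂_congr fun e he => by rw [heq e he]
  · refine fun h => ⟨rfl, fun e hmem hve => ne_of_mem_SepSet hmem ?_⟩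
    have he : X e = 0 := (hvX e).symm.trans (sign_eq_zero_iff.2 hve)
    obtain ⟨w, hwT, hwK⟩ := T.2.1
    have hw : w ∈ KXT f K X T.1 := ⟨hwK, Set.mem_iInter₂.2 fun i _ => hwT i⟩
    rw [h] at hw
    exact (hwT e).symm.trans (Set.mem_iInter₂.1 hw.2 e he)
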